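/- arXiv:0901.0618 — 8 statements merged into one kernel-verified Lean document; each statement's English description precedes it below -/
import Mathlib

section
/- For every V-category (X,a) and all subsets A, B ⊆ X, the Hausdorff structure satisfies h_X(A,B) = ⋀_{x∈A} ⋁_{y∈B} a(x,y). -/
universe u v

/-- A commutative unital quantale: a complete lattice with a commutative monoid
structure whose multiplication preserves arbitrary suprema in each variable,
and whose unit `k = 1` satisfies `⊥ < 1`. -/
class CommQuantale (V : Type u) extends CompleteLattice V, CommMonoid V where
  mul_sSup : ∀ (a : V) (s : Set V), a * sSup s = ⨆ b ∈ s, a * b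
  bot_lt_one : (⊥ : V) < 1

variable {V : Type u} [CommQuantale V]

/-- The internal hom `x ⊸ y` of the quantale, characterized by `z ≤ x ⊸ y ↔ z * x ≤ y`. -/
def qhom (x y : V) : V := sSup {z : V | z * x ≤ y}

/-- `a : X → X → V` is a `V`-category structure. -/
def IsVCat {X : Type*} (a : X → X → V) : Prop :=
  (∀ x, (1 : V) ≤ a x x) ∧ (∀ x y z, a x y * a y z ≤ a x z)

/-- `f` is a `V`-functor from `(X,a)` to `(Y,b)`. -/
def IsVFun {X Y : Type*} (a : X → X → V) (b : Y → Y → V) (f : X → Y) : Prop :=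
  ∀ x y, a x y ≤ b (f x) (f y)

/-- `φ` is a `V`-module from `(X,a)` to `(Y,b)`. -/
def IsVMod {X Y : Type*} (a : X → X → V) (b : Y → Y → V) (φ : X → Y → V) : Prop :=
  (∀ x' x y, a x' x * φ x y ≤ φ x' y) ∧ (∀ x y y', φ x y * b y y' ≤ φ x y')

/-- The Hausdorff formula: for `φ = a` this is the Hausdorff structure `h_X` on `P X`;
for a `V`-module `φ` it is the lax (Hausdorff) extension `H̃φ`. -/
def hf {X Y : Type*} (φ : X → Y → V) (A : Set X) (B : Set Y) : V :=
  ⨅ x ∈ A, ⨆ y ∈ B, φ x y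

/-- Module composition: `mcomp φ ψ` is `ψ · φ` in the paper's notation. -/
def mcomp {X Y Z : Type*} (φ : X → Y → V) (ψ : Y → Z → V) : X → Z → V :=
  fun x z => ⨆ y, φ x y * ψ y z

/-- The Gromov–Hausdorff "distance": the join of `H̃φ(X,Y)` over all `V`-modules
`φ : X ⇸ Y`. -/
def GH {X Y : Type*} (a : X → X → V) (b : Y → Y → V) : V :=
  ⨆ φ : {φ : X → Y → V // IsVMod a b φ}, hf φ.1 Set.univ Set.univ

theorem cq_mul_mono_left (c : V) {x y : V} (h : x ≤ y) : c * x ≤ c * y := by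
  have h2 := CommQuantale.mul_sSup c {x, y}
  rw [sSup_pair, sup_eq_right.2 h] at h2
  rw [h2]
  exact le_iSup₂_of_le x (Set.mem_insert x _) le_rfl

theorem cq_mul_iSup_le {ι : Type*} (c d : V) (f : ι → V) (s : Set ι)
    (h : ∀ i ∈ s, c * f i ≤ d) : c * (⨆ i ∈ s, f i) ≤ d := by
  rw [← sSup_image, CommQuantale.mul_sSup]
  refine iSup₂_le ?_
  rintro _ ⟨i, hi, rfl⟩
  exact h i hi

theorem le_qhom_iff (x y z : V) : z ≤ qhom x y ↔ z * x ≤ y := by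
  constructor
  · intro h
    have h1 : x * z ≤ x * qhom x y := cq_mul_mono_left x h
    rw [mul_comm]
    refine h1.trans ?_
    unfold qhom
    rw [CommQuantale.mul_sSup]
    refine iSup₂_le fun w hw => ?_
    rw [mul_comm]
    exact hw
  · intro h
    exact le_sSup h

/-- For every V-category (X,a) and all subsets A, B ⊆ X, the Hausdorff
structure `h_X(A,B) = ⋀_z (a(z,A) ⊸ a(z,B))` satisfies
`h_X(A,B) = ⋀_{x∈A} ⋁_{y∈B} a(x,y)`. -/
theorem hausdorff_formula {X : Type v} (a : X → X → V) (ha : IsVCat a) (A B : Set X) :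
    (⨅ z : X, qhom (⨆ y ∈ A, a z y) (⨆ y ∈ B, a z y)) = ⨅ x ∈ A, ⨆ y ∈ B, a x y := by
  apply le_antisymm
  · refine le_iInf₂ fun x hx => ?_
    have h1 := (le_qhom_iff _ _ _).1
      (iInf_le (fun z : X => qhom (⨆ y ∈ A, a z y) (⨆ y ∈ B, a z y)) x)
    refine le_trans ?_ h1
    have h2 : (1 : V) ≤ ⨆ y ∈ A, a x y := le_iSup₂_of_le x hx (ha.1 x)
    have h3 := cq_mul_mono_left (⨅ z : X, qhom (⨆ y ∈ A, a z y) (⨆ y ∈ B, a z y)) h2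
    rwa [mul_one] at h3
  · refine le_iInf fun z => (le_qhom_iff _ _ _).2 (cq_mul_iSup_le _ _ _ _ fun x hx => ?_)
    rw [mul_comm]
    refine (cq_mul_mono_left (a z x) (iInf₂_le x hx)).trans ?_
    refine cq_mul_iSup_le _ _ _ _ fun y hy => ?_
    exact (ha.2 z x y).trans (le_iSup₂_of_le y hy le_rfl)
end

section
/- For every V-category (X,a): (i) h_X is a V-category structure on the powerset PX, giving HX = (PX, h_X); (ii) for every V-functor f : (X,a) → (Y,b), the direct-image map Hf : PX → PY, A ↦ f(A), satisfies h_X(A,B) ≤ h_Y(f(A), f(B)), so Hf : HX → HY is a V-functor; (iii) the singleton map {-} : X → HX is a fully faithful V-functor, i.e. h_X({x},{y}) = a(x,y) for all x,y ∈ X; (iv) the union map ⋃ : HHX → HX satisfies h_{HX}(𝒜, ℬ) ≤ h_X(⋃𝒜, ⋃ℬ) for all 𝒜, ℬ ⊆ PX, so it is a V-functor. Hence the powerset monad on Set lifts along the forgetful functor VCat → Set to a monad ℍ = (H, {-}, ⋃) on VCat. -/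
universe u v

variable {V : Type u} [CommQuantale V]

theorem q_mul_biSup_le {ι : Type*} (x c : V) (B : Set ι) (g : ι → V)
    (h : ∀ y ∈ B, x * g y ≤ c) : x * (⨆ y ∈ B, g y) ≤ c := by
  rw [← sSup_image, CommQuantale.mul_sSup]
  refine iSup₂_le ?_
  rintro _ ⟨y, hy, rfl⟩
  exact h y hy

theorem q_mul_mono (x : V) {b c : V} (h : b ≤ c) : x * b ≤ x * c := by
  have e : c = sSup {b, c} := by rw [sSup_pair, sup_eq_right.2 h]
  conv_rhs => rw [e, CommQuantale.mul_sSup]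
  exact le_iSup₂_of_le b (by simp) le_rfl

theorem hf_le {X Y : Type*} (φ : X → Y → V) {A : Set X} (B : Set Y) {x : X} (hx : x ∈ A) :
    hf φ A B ≤ ⨆ y ∈ B, φ x y := iInf₂_le x hx

theorem hf_trans {X : Type*} (a : X → X → V) (ha : IsVCat a) (A B C : Set X) :
    hf a A B * hf a B C ≤ hf a A C := by
  refine le_iInf₂ fun x hx => ?_
  rw [mul_comm]
  refine (q_mul_mono _ (hf_le a B hx)).trans ?_
  refine q_mul_biSup_le _ _ _ _ fun y hy => ?_
  rw [mul_comm]
  refine (q_mul_mono _ (hf_le a C hy)).trans ?_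
  refine q_mul_biSup_le _ _ _ _ fun z hz => ?_
  exact (ha.2 x y z).trans (le_iSup₂_of_le z hz le_rfl)

/-- (i) `h_X` is a V-category structure on the powerset, giving `HX`;
(ii) for every V-functor `f : (X,a) → (Y,b)`, `h_X(A,B) ≤ h_Y(f(A),f(B))`, so
`Hf : HX → HY, A ↦ f(A)` is a V-functor; (iii) the singleton map is a fully faithful
V-functor, i.e. `h_X({x},{y}) = a(x,y)`; (iv) the union map `HHX → HX` is a V-functor,
i.e. `h_{HX}(𝒜,ℬ) ≤ h_X(⋃𝒜, ⋃ℬ)`.  Hence the powerset monad lifts to a monad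
`ℍ = (H, {-}, ⋃)` on VCat. -/
theorem hausdorff_monad_lifting {X : Type v} (a : X → X → V) (ha : IsVCat a) :
    IsVCat (hf a) ∧
    (∀ (Y : Type v) (b : Y → Y → V), IsVCat b → ∀ f : X → Y, IsVFun a b f →
        ∀ A B : Set X, hf a A B ≤ hf b (f '' A) (f '' B)) ∧
    (∀ x y : X, hf a ({x} : Set X) ({y} : Set X) = a x y) ∧
    IsVFun a (hf a) (fun x => ({x} : Set X)) ∧
    (∀ 𝒜 ℬ : Set (Set X), hf (hf a) 𝒜 ℬ ≤ hf a (⋃₀ 𝒜) (⋃₀ ℬ)) ∧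
    IsVFun (hf (hf a)) (hf a) Set.sUnion := by
  have hs : ∀ x y : X, hf a ({x} : Set X) ({y} : Set X) = a x y := by
    intro x y
    simp [hf]
  have hu : ∀ 𝒜 ℬ : Set (Set X), hf (hf a) 𝒜 ℬ ≤ hf a (⋃₀ 𝒜) (⋃₀ ℬ) := by
    intro 𝒜 ℬ
    refine le_iInf₂ fun x hx => ?_
    obtain ⟨A, hA, hxA⟩ := hx
    refine (hf_le (hf a) ℬ hA).trans (iSup₂_le fun B hB => ?_)
    refine (hf_le a B hxA).trans (iSup₂_le fun y hy => ?_)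
    exact le_iSup₂_of_le y ⟨B, hB, hy⟩ le_rfl
  refine ⟨⟨fun A => le_iInf₂ fun x hx => le_iSup₂_of_le x hx (ha.1 x), hf_trans a ha⟩,
    ?_, hs, fun x y => (hs x y).ge, hu, hu⟩
  intro Y b _ f hfun A B
  refine le_iInf₂ ?_
  rintro _ ⟨x, hx, rfl⟩
  refine (hf_le a B hx).trans (iSup₂_le fun y hy => ?_)
  exact le_iSup₂_of_le (f y) ⟨y, hy, rfl⟩ (hfun x y)
end

section
/- For a V-category (X,a) define ⇓_X B = {x ∈ X : k ≤ a(x,B)} for B ⊆ X. Then: (i) a(z, ⇓_X B) = a(z, B) for all z ∈ X and B ⊆ X; (ii) h_X(A,B) = h_X(⇓_X A, ⇓_X B) for all A, B ⊆ X; (iii) ⇓_X ⇓_X B = ⇓_X B for all B ⊆ X. -/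
universe u v

variable {V : Type u} [CommQuantale V]

/-- `⇓_X B = {x ∈ X : k ≤ a(x,B)}`. -/
def dcl {X : Type*} (a : X → X → V) (B : Set X) : Set X :=
  {x : X | (1 : V) ≤ ⨆ y ∈ B, a x y}

theorem cq_mul_biSup_le {X : Type*} (c d : V) (B : Set X) (f : X → V)
    (h : ∀ y ∈ B, c * f y ≤ d) : c * (⨆ y ∈ B, f y) ≤ d := by
  rw [← sSup_image, CommQuantale.mul_sSup]
  refine iSup₂_le ?_
  rintro _ ⟨y, hy, rfl⟩
  exact h y hy

theorem cq_mul_le_mul_left (c x y : V) (h : x ≤ y) : c * x ≤ c * y := by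
  have h1 := CommQuantale.mul_sSup c {x, y}
  rw [sSup_pair, sup_eq_right.2 h] at h1
  rw [h1]
  exact le_iSup₂_of_le x (by simp) le_rfl

theorem cq_le_of_one_le {X : Type*} (c d : V) (B : Set X) (f : X → V)
    (h1 : (1 : V) ≤ ⨆ y ∈ B, f y) (h : ∀ y ∈ B, c * f y ≤ d) : c ≤ d := by
  have := cq_mul_le_mul_left c _ _ h1
  rw [mul_one] at this
  exact this.trans (cq_mul_biSup_le c d B f h)

/-- (i) `a(z, ⇓_X B) = a(z,B)`; (ii) `h_X(A,B) = h_X(⇓_X A, ⇓_X B)`;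
(iii) `⇓_X ⇓_X B = ⇓_X B`. -/
theorem dcl_properties {X : Type v} (a : X → X → V) (ha : IsVCat a) :
    (∀ (z : X) (B : Set X), (⨆ y ∈ dcl a B, a z y) = ⨆ y ∈ B, a z y) ∧
    (∀ A B : Set X, hf a A B = hf a (dcl a A) (dcl a B)) ∧
    (∀ B : Set X, dcl a (dcl a B) = dcl a B) := by
  obtain ⟨hr, ht⟩ := ha
  have hsub : ∀ (B : Set X), ∀ y ∈ B, y ∈ dcl a B := fun B y hy =>
    (hr y).trans (le_iSup₂_of_le (f := fun z (_ : z ∈ B) => a y z) y hy le_rfl)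
  have h1 : ∀ (z : X) (B : Set X), (⨆ y ∈ dcl a B, a z y) = ⨆ y ∈ B, a z y := by
    intro z B
    apply le_antisymm
    · refine iSup₂_le fun y hy => ?_
      refine cq_le_of_one_le _ _ B (a y) hy fun w hw => ?_
      exact (ht z y w).trans (le_iSup₂_of_le (f := fun v (_ : v ∈ B) => a z v) w hw le_rfl)
    · exact iSup₂_le fun y hy =>
        le_iSup₂_of_le (f := fun v (_ : v ∈ dcl a B) => a z v) y (hsub B y hy) le_rfl
  refine ⟨h1, fun A B => ?_, fun B => ?_⟩
  · simp only [hf, h1]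
    apply le_antisymm
    · refine le_iInf₂ fun x hx => ?_
      refine cq_le_of_one_le _ _ A (a x) hx fun w hw => ?_
      have h2 : (⨅ x ∈ A, ⨆ y ∈ B, a x y) ≤ ⨆ y ∈ B, a w y := iInf₂_le w hw
      rw [mul_comm]
      refine (cq_mul_le_mul_left _ _ _ h2).trans (cq_mul_biSup_le _ _ B _ fun y hy => ?_)
      exact (ht x w y).trans (le_iSup₂_of_le (f := fun v (_ : v ∈ B) => a x v) y hy le_rfl)
    · exact le_iInf₂ fun x hx => iInf₂_le x (hsub A x hx)
  · ext x
    change (1 : V) ≤ _ ↔ (1 : V) ≤ _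
    rw [h1]
end

section
/- A V-module α : HX ⇸ X satisfies α · δ_X = 1_X^* and α · ν_X = α · H̃α if and only if α(A,y) = h_X(A,{y}) = ⋀_{x∈A} a(x,y) for all A ⊆ X, y ∈ X. Moreover, with this unique structure α on X and the corresponding β(B,z) = ⋀_{y∈B} b(y,z) on Y, every V-module φ : X ⇸ Y satisfies φ · α ≤ β · H̃φ. Hence the category of strict H̃-algebras and lax homomorphisms is VMod itself. -/
universe u v

variable {V : Type u} [CommQuantale V]

/-- The unit `δ_X : X ⇸ HX`, `δ_X(x,B) = ⋁_{y∈B} a(x,y)`. -/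
def deltaMod {X : Type*} (a : X → X → V) : X → Set X → V :=
  fun x B => ⨆ y ∈ B, a x y

/-- The multiplication `ν_X : HHX ⇸ HX`, `ν_X(𝒜,B) = h_X(⋃𝒜, B)`. -/
def nuMod {X : Type*} (a : X → X → V) : Set (Set X) → Set X → V :=
  fun 𝒜 B => hf a (⋃₀ 𝒜) B

theorem cq_mul_le_mul_left_s10 {V : Type u} [CommQuantale V] (a : V) {b c : V} (h : b ≤ c) :
    a * b ≤ a * c := by
  have h1 : sSup ({b, c} : Set V) = c := by rw [sSup_pair]; exact sup_eq_right.2 h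
  have h2 := CommQuantale.mul_sSup a ({b, c} : Set V)
  rw [h1] at h2
  rw [h2]
  exact le_iSup₂_of_le b (by simp) le_rfl

theorem cq_mul_le_mul {V : Type u} [CommQuantale V] {a b c d : V} (h : a ≤ b) (h' : c ≤ d) :
    a * c ≤ b * d := by
  refine (cq_mul_le_mul_left_s10 a h').trans ?_
  rw [mul_comm a, mul_comm b]
  exact cq_mul_le_mul_left_s10 d h

theorem cq_le_mul_one {V : Type u} [CommQuantale V] {a b : V} (h : 1 ≤ b) : a ≤ a * b := by
  simpa using cq_mul_le_mul (le_refl a) h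

theorem cq_le_one_mul {V : Type u} [CommQuantale V] {a b : V} (h : 1 ≤ b) : a ≤ b * a := by
  simpa using cq_mul_le_mul h (le_refl a)

theorem cq_biSup_mul_le {V : Type u} [CommQuantale V] {W : Type*} (B : Set W) (f : W → V)
    (c d : V) (h : ∀ w ∈ B, f w * c ≤ d) : (⨆ w ∈ B, f w) * c ≤ d := by
  rw [← sSup_image, mul_comm, CommQuantale.mul_sSup]
  refine iSup₂_le ?_
  rintro _ ⟨w, hw, rfl⟩
  rw [mul_comm]
  exact h w hw

theorem cq_one_le_hf {V : Type u} [CommQuantale V] {X : Type*} (a : X → X → V) (ha : IsVCat a)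
    (A : Set X) : 1 ≤ hf a A A :=
  le_iInf₂ fun x hx => le_iSup₂_of_le x hx (ha.1 x)

theorem cq_nu {V : Type u} [CommQuantale V] {X : Type*} (a : X → X → V) (ha : IsVCat a)
    (α : Set X → X → V) (hα : IsVMod (hf a) a α) (S : Set (Set X)) (y : X) :
    mcomp (nuMod a) α S y = α (⋃₀ S) y := by
  apply le_antisymm
  · exact iSup_le fun B => hα.1 _ _ _
  · exact le_iSup_of_le (⋃₀ S) (cq_le_one_mul (cq_one_le_hf a ha _))

/-- a V-module `α : HX ⇸ X` satisfies `α · δ_X = 1_X^*` and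
`α · ν_X = α · H̃α` iff `α(A,y) = h_X(A,{y}) = ⋀_{x∈A} a(x,y)`.  Moreover, with this
unique structure `α` on `X` and the corresponding `β` on `Y`, every V-module
`φ : X ⇸ Y` satisfies `φ · α ≤ β · H̃φ`.  Hence strict `H̃`-algebras with lax
homomorphisms form VMod itself. (Recall `mcomp ρ σ` denotes `σ · ρ`.) -/
theorem hausdorff_lax_monad_algebras {X Y : Type v} (a : X → X → V) (b : Y → Y → V)
    (ha : IsVCat a) (hb : IsVCat b) :
    (∀ α : Set X → X → V, IsVMod (hf a) a α →
      ((mcomp (deltaMod a) α = a ∧ mcomp (nuMod a) α = mcomp (hf α) α)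
        ↔ α = fun (A : Set X) (y : X) => ⨅ x ∈ A, a x y)) ∧
    (∀ φ : X → Y → V, IsVMod a b φ → ∀ (A : Set X) (z : Y),
      mcomp (fun (A : Set X) (y : X) => ⨅ x ∈ A, a x y) φ A z
        ≤ mcomp (hf φ) (fun (B : Set Y) (z : Y) => ⨅ y ∈ B, b y z) A z) := by
  refine ⟨fun α hα => ⟨?_, ?_⟩, ?_⟩
  · rintro ⟨h1, h2⟩
    have hsing : ∀ x y, a x y ≤ α {x} y := by
      intro x y
      have e := congrFun (congrFun h1 x) y
      rw [← e]
      refine iSup_le fun B => ?_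
      refine le_trans (cq_mul_le_mul ?_ le_rfl) (hα.1 {x} B y)
      simp [hf, deltaMod]
    funext A y
    apply le_antisymm
    · refine le_iInf₂ fun x hx => ?_
      have e := congrFun (congrFun h1 x) y
      rw [← e]
      exact le_iSup_of_le A (cq_le_one_mul (le_iSup₂_of_le x hx (ha.1 x)))
    · have e := congrFun (congrFun h2 ((fun x => ({x} : Set X)) '' A)) y
      rw [cq_nu a ha α hα] at e
      have hu : ⋃₀ ((fun x => ({x} : Set X)) '' A) = A := by
        ext t; simp
      rw [hu] at e
      rw [e]
      refine le_iSup_of_le {y} ?_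
      refine le_trans ?_ (cq_le_mul_one ((ha.1 y).trans (hsing y y)))
      refine le_iInf₂ ?_
      rintro _ ⟨x, hx, rfl⟩
      refine le_iSup₂_of_le y rfl ?_
      exact (iInf₂_le x hx).trans (hsing x y)
  · intro h
    have hA : ∀ A y, α A y = ⨅ x ∈ A, a x y := fun A y => by rw [h]
    clear h
    constructor
    · funext x y
      apply le_antisymm
      · refine iSup_le fun B => cq_biSup_mul_le _ _ _ _ fun w hw => ?_
        rw [hA]
        exact (cq_mul_le_mul_left_s10 _ (iInf₂_le w hw)).trans (ha.2 _ _ _)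
      · refine le_iSup_of_le {y} ?_
        refine le_trans (b := deltaMod a x {y}) (le_iSup₂_of_le y rfl le_rfl) (cq_le_mul_one ?_)
        rw [hA]
        refine le_iInf₂ ?_
        rintro _ rfl
        exact ha.1 _
    · funext S y
      rw [cq_nu a ha α hα]
      apply le_antisymm
      · refine le_iSup_of_le {y} ?_
        refine le_trans ?_ (cq_le_mul_one ?_)
        · refine le_iInf₂ fun A hAS => le_iSup₂_of_le y rfl ?_
          rw [hA, hA]
          exact le_iInf₂ fun x hx => iInf₂_le x ⟨A, hAS, hx⟩
        · rw [hA]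
          refine le_iInf₂ ?_
          rintro _ rfl
          exact ha.1 _
      · refine iSup_le fun B => ?_
        rw [hA (⋃₀ S)]
        refine le_iInf₂ ?_
        rintro x ⟨A, hAS, hx⟩
        refine (cq_mul_le_mul (iInf₂_le A hAS) le_rfl).trans ?_
        refine cq_biSup_mul_le _ _ _ _ fun w hw => ?_
        rw [hA, hA]
        exact (cq_mul_le_mul (iInf₂_le x hx) (iInf₂_le w hw)).trans (ha.2 _ _ _)
  · intro φ hφ A z
    refine iSup_le fun x => le_iSup_of_le {z} ?_
    refine le_trans ?_ (cq_le_mul_one ?_)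
    · refine le_iInf₂ fun x' hx' => le_iSup₂_of_le z rfl ?_
      exact (cq_mul_le_mul (iInf₂_le x' hx') le_rfl).trans (hφ.1 _ _ _)
    · refine le_iInf₂ ?_
      rintro _ rfl
      exact hb.1 _
end

section
/- The Gromov–Hausdorff structure GH(X,Y) = ⋁_{φ : X ⇸ Y} H̃φ(X,Y) is a V-category structure on isomorphism classes of V-categories: (i) k ≤ GH(X,X) for every V-category X; (ii) GH(X,Y) ⊗ GH(Y,Z) ≤ GH(X,Z) for all V-categories X, Y, Z; (iii) GH(X,Y) = GH(X',Y') whenever X ≅ X' and Y ≅ Y' in VCat (i.e. there exist mutually inverse V-functors). -/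
universe u v

variable {V : Type u} [CommQuantale V]

/-- Isomorphism of V-categories: mutually inverse V-functors. -/
def VIso {X Y : Type*} (a : X → X → V) (b : Y → Y → V) : Prop :=
  ∃ (f : X → Y) (g : Y → X), IsVFun a b f ∧ IsVFun b a g ∧
    (∀ x, g (f x) = x) ∧ (∀ y, f (g y) = y)

theorem CQ.mul_iSup' {ι : Sort*} (a : V) (f : ι → V) : a * (⨆ i, f i) = ⨆ i, a * f i := by
  rw [iSup, CommQuantale.mul_sSup, iSup_range]

theorem CQ.mul_le_left (a : V) {b c : V} (h : b ≤ c) : a * b ≤ a * c := by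
  have h1 := CommQuantale.mul_sSup a {b, c}
  rw [sSup_pair, sup_eq_right.2 h] at h1
  rw [h1]
  exact le_iSup₂_of_le b (by simp) le_rfl

theorem CQ.mul_le {a b c d : V} (h : a ≤ b) (h' : c ≤ d) : a * c ≤ b * d := by
  refine (CQ.mul_le_left a h').trans ?_
  rw [mul_comm a, mul_comm b]
  exact CQ.mul_le_left d h

theorem CQ.iSup_mul' {ι : Sort*} (a : V) (f : ι → V) : (⨆ i, f i) * a = ⨆ i, f i * a := by
  simp only [mul_comm _ a, CQ.mul_iSup']

theorem CQ.hf_univ {X Y : Type*} (φ : X → Y → V) :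
    hf φ Set.univ Set.univ = ⨅ x, ⨆ y, φ x y := by
  simp [hf]

theorem CQ.mcomp_mod {X Y Z : Type*} {a : X → X → V} {b : Y → Y → V} {c : Z → Z → V}
    {φ : X → Y → V} {ψ : Y → Z → V} (h : IsVMod a b φ) (h' : IsVMod b c ψ) :
    IsVMod a c (mcomp φ ψ) := by
  refine ⟨fun x' x z => ?_, fun x z z' => ?_⟩
  · simp only [mcomp, CQ.mul_iSup']
    refine iSup_mono fun y => ?_
    rw [← mul_assoc]
    exact CQ.mul_le (h.1 _ _ _) le_rfl
  · simp only [mcomp, CQ.iSup_mul']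
    refine iSup_mono fun y => ?_
    rw [mul_assoc]
    exact CQ.mul_le le_rfl (h'.2 _ _ _)

theorem CQ.hf_mcomp {X Y Z : Type*} (φ : X → Y → V) (ψ : Y → Z → V) :
    hf φ Set.univ Set.univ * hf ψ Set.univ Set.univ ≤ hf (mcomp φ ψ) Set.univ Set.univ := by
  simp only [CQ.hf_univ]
  refine le_iInf fun x => ?_
  refine (CQ.mul_le (iInf_le _ x) le_rfl).trans ?_
  rw [CQ.iSup_mul']
  refine iSup_le fun y => ?_
  refine (CQ.mul_le le_rfl (iInf_le _ y)).trans ?_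
  rw [CQ.mul_iSup']
  exact iSup_mono fun z => le_iSup (fun y => φ x y * ψ y z) y

theorem CQ.GH_iso_le {X X' Y Y' : Type*} {a : X → X → V} {a' : X' → X' → V}
    {b : Y → Y → V} {b' : Y' → Y' → V} (h : VIso a a') (h' : VIso b b') :
    GH a b ≤ GH a' b' := by
  obtain ⟨f, g, hf1, hg, hgf, hfg⟩ := h
  obtain ⟨p, q, hp, hq, hqp, hpq⟩ := h'
  refine iSup_le fun φ => ?_
  refine le_iSup_of_le ⟨fun x y => φ.1 (g x) (q y), ?_, ?_⟩ ?_
  · exact fun x' x y => (CQ.mul_le (hg _ _) le_rfl).trans (φ.2.1 _ _ _)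
  · exact fun x y y' => (CQ.mul_le le_rfl (hq _ _)).trans (φ.2.2 _ _ _)
  · simp only [CQ.hf_univ]
    refine le_iInf fun x => (iInf_le _ (g x)).trans (iSup_le fun y => ?_)
    refine le_iSup_of_le (p y) ?_
    rw [hqp]

/-- `GH(X,Y) = ⋁_{φ : X ⇸ Y} H̃φ(X,Y)` is a V-category structure on
isomorphism classes of V-categories: (i) `k ≤ GH(X,X)`;
(ii) `GH(X,Y) ⊗ GH(Y,Z) ≤ GH(X,Z)`; (iii) `GH` is invariant under isomorphism. -/
theorem GH_structure :
    (∀ (X : Type v) (a : X → X → V), IsVCat a → (1 : V) ≤ GH a a) ∧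
    (∀ (X Y Z : Type v) (a : X → X → V) (b : Y → Y → V) (c : Z → Z → V),
      IsVCat a → IsVCat b → IsVCat c → GH a b * GH b c ≤ GH a c) ∧
    (∀ (X X' Y Y' : Type v) (a : X → X → V) (a' : X' → X' → V)
        (b : Y → Y → V) (b' : Y' → Y' → V),
      IsVCat a → IsVCat a' → IsVCat b → IsVCat b' →
      VIso a a' → VIso b b' → GH a b = GH a' b') := by
  refine ⟨fun X a ha => ?_, fun X Y Z a b c _ _ _ => ?_, ?_⟩
  · refine le_iSup_of_le ⟨a, ha.2, ha.2⟩ ?_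
    rw [CQ.hf_univ]
    exact le_iInf fun x => le_iSup_of_le x (ha.1 x)
  · unfold GH
    rw [CQ.iSup_mul']
    refine iSup_le fun φ => ?_
    rw [CQ.mul_iSup']
    refine iSup_le fun ψ => ?_
    exact le_iSup_of_le ⟨mcomp φ.1 ψ.1, CQ.mcomp_mod φ.2 ψ.2⟩ (CQ.hf_mcomp _ _)
  · intro X X' Y Y' a a' b b' _ _ _ _ h h'
    have sy : ∀ {X Y : Type v} {a : X → X → V} {b : Y → Y → V}, VIso a b → VIso b a := by
      rintro X Y a b ⟨f, g, h1, h2, h3, h4⟩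
      exact ⟨g, f, h2, h1, h4, h3⟩
    exact le_antisymm (CQ.GH_iso_le h h') (CQ.GH_iso_le (sy h) (sy h'))
end

section
/- For all V-categories X = (X,a) and Y = (Y,b): GH(X,Y) = ⋁_{X ↪ Z ↩ Y} h_Z(X,Y) = ⋁_c ⋀_{x∈X} ⋁_{y∈Y} c(x,y), where the first join ranges over all V-categories Z together with fully faithful injective V-functors from X and from Y into Z (h_Z evaluated at the images of X and Y), and the second join ranges over all V-category structures c on the disjoint union X ⊔ Y whose restrictions to X and to Y are a and b respectively. -/
universe u v

variable {V : Type u} [CommQuantale V]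

theorem q_mul_bot (x : V) : x * (⊥ : V) = ⊥ := by
  have h := CommQuantale.mul_sSup x (∅ : Set V)
  simpa using h

theorem q_bot_mul (x : V) : (⊥ : V) * x = ⊥ := by
  rw [mul_comm]; exact q_mul_bot x

/-- The collage of a module. -/
def collage {X Y : Type*} (a : X → X → V) (b : Y → Y → V) (φ : X → Y → V) :
    (X ⊕ Y) → (X ⊕ Y) → V
  | Sum.inl x, Sum.inl x' => a x x'
  | Sum.inl x, Sum.inr y => φ x y
  | Sum.inr _, Sum.inl _ => ⊥
  | Sum.inr y, Sum.inr y' => b y y'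

theorem collage_isVCat {X Y : Type*} {a : X → X → V} {b : Y → Y → V} {φ : X → Y → V}
    (ha : IsVCat a) (hb : IsVCat b) (hφ : IsVMod a b φ) : IsVCat (collage a b φ) := by
  refine ⟨?_, ?_⟩
  · rintro (x | y)
    · exact ha.1 x
    · exact hb.1 y
  · rintro (x | x) (y | y) (z | z) <;>
      simp only [collage, q_mul_bot, q_bot_mul, bot_le, le_refl]
    · exact ha.2 _ _ _
    · exact hφ.1 _ _ _
    · exact hφ.2 _ _ _
    · exact hb.2 _ _ _

/-- `GH(X,Y) = ⋁_{X ↪ Z ↩ Y} h_Z(X,Y)`, the join over all V-categories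
`Z` with fully faithful injective V-functors from `X` and from `Y`, and also
`GH(X,Y) = ⋁_c ⋀_{x∈X} ⋁_{y∈Y} c(x,y)`, the join over all V-category structures `c`
on the disjoint union `X ⊔ Y` restricting to `a` on `X` and to `b` on `Y`. -/
theorem GH_via_amalgamation {X Y : Type v} (a : X → X → V) (b : Y → Y → V)
    (ha : IsVCat a) (hb : IsVCat b) :
    (GH a b
      = ⨆ (Z : Type v) (c : Z → Z → V) (_ : IsVCat c) (f : X → Z) (g : Y → Z)
          (_ : Function.Injective f) (_ : Function.Injective g)
          (_ : ∀ x x', a x x' = c (f x) (f x'))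
          (_ : ∀ y y', b y y' = c (g y) (g y')),
          hf c (Set.range f) (Set.range g)) ∧
    (GH a b
      = ⨆ (c : (X ⊕ Y) → (X ⊕ Y) → V) (_ : IsVCat c)
          (_ : ∀ x x', c (Sum.inl x) (Sum.inl x') = a x x')
          (_ : ∀ y y', c (Sum.inr y) (Sum.inr y') = b y y'),
          ⨅ x : X, ⨆ y : Y, c (Sum.inl x) (Sum.inr y)) := by
  refine ⟨le_antisymm ?_ ?_, le_antisymm ?_ ?_⟩
  · refine iSup_le fun φ => ?_
    refine le_iSup_of_le (X ⊕ Y) <| le_iSup_of_le (collage a b φ.1) <|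
      le_iSup_of_le (collage_isVCat ha hb φ.2) <| le_iSup_of_le Sum.inl <|
      le_iSup_of_le Sum.inr <| le_iSup_of_le Sum.inl_injective <|
      le_iSup_of_le Sum.inr_injective <| le_iSup_of_le (fun _ _ => rfl) <|
      le_iSup_of_le (fun _ _ => rfl) ?_
    simp only [hf, iInf_range, iSup_range, iInf_univ, iSup_univ, collage, le_refl]
  · refine iSup_le fun Z => iSup_le fun c => iSup_le fun hc => iSup_le fun f => iSup_le fun g =>
      iSup_le fun _ => iSup_le fun _ => iSup_le fun hf' => iSup_le fun hg' => ?_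
    refine le_iSup_of_le ⟨fun x y => c (f x) (g y), ?_, ?_⟩ ?_
    · intro x' x y
      rw [hf']; exact hc.2 _ _ _
    · intro x y y'
      rw [hg']; exact hc.2 _ _ _
    · simp only [hf, iInf_range, iSup_range, iInf_univ, iSup_univ, le_refl]
  · refine iSup_le fun φ => ?_
    refine le_iSup_of_le (collage a b φ.1) <|
      le_iSup_of_le (collage_isVCat ha hb φ.2) <| le_iSup_of_le (fun _ _ => rfl) <|
      le_iSup_of_le (fun _ _ => rfl) ?_
    simp [hf, collage]
  · refine iSup_le fun c => iSup_le fun hc => iSup_le fun h1 => iSup_le fun h2 => ?_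
    refine le_iSup_of_le ⟨fun x y => c (Sum.inl x) (Sum.inr y), ?_, ?_⟩ ?_
    · intro x' x y
      rw [← h1]; exact hc.2 _ _ _
    · intro x y y'
      rw [← h2]; exact hc.2 _ _ _
    · simp [hf]
end

section
/- Assume k = ⊤ in V. Then for all V-categories X, X', Y, Y': GH(X,X') ⊗ GH(Y,Y') ≤ GH(X × Y, X' × Y') and GH(X,X') ⊗ GH(Y,Y') ≤ GH(X + Y, X' + Y'), where X × Y = (X × Y, a × b) with (a × b)((x,y),(x',y')) = a(x,x') ∧ b(y,y'), and X + Y is the disjoint union X ⊔ Y with structure a + b equal to a on X, to b on Y, and to ⊥ between points of X and points of Y. (Hence both product and coproduct make the Gromov–Hausdorff V-category a monoid in the monoidal category of large V-categories.) -/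
universe u v

variable {V : Type u} [CommQuantale V]

/-- The coproduct structure `a + b` on the disjoint union `X ⊔ Y`: `a` on `X`,
`b` on `Y`, and `⊥` between points of `X` and points of `Y`. -/
def sumStruct {X Y : Type*} (a : X → X → V) (b : Y → Y → V) : X ⊕ Y → X ⊕ Y → V
  | Sum.inl x, Sum.inl x' => a x x'
  | Sum.inr y, Sum.inr y' => b y y'
  | _, _ => ⊥

theorem cq_mul_mono {p q r s : V} (h : p ≤ q) (h' : r ≤ s) : p * r ≤ q * s := by
  have key : ∀ c x y : V, x ≤ y → c * x ≤ c * y := by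
    intro c x y hxy
    have e : sSup {x, y} = y := by rw [sSup_pair]; exact sup_eq_right.mpr hxy
    have := CommQuantale.mul_sSup c {x, y}
    rw [e] at this
    rw [this]
    exact le_iSup₂_of_le x (by simp) le_rfl
  refine (key p r s h').trans ?_
  rw [mul_comm p, mul_comm q]
  exact key s p q h

theorem cq_mul_iSup {ι : Sort*} (c : V) (f : ι → V) : c * (⨆ i, f i) = ⨆ i, c * f i := by
  rw [iSup, CommQuantale.mul_sSup, iSup_range]

theorem cq_iSup_mul_le {ι κ : Sort*} (f : ι → V) (g : κ → V) (z : V)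
    (h : ∀ i j, f i * g j ≤ z) : (⨆ i, f i) * (⨆ j, g j) ≤ z := by
  rw [cq_mul_iSup]
  refine iSup_le fun j => ?_
  rw [mul_comm, cq_mul_iSup]
  refine iSup_le fun i => ?_
  rw [mul_comm]
  exact h i j

theorem cq_mul_bot (c : V) : c * ⊥ = ⊥ := by
  have := CommQuantale.mul_sSup c ∅
  simpa using this

theorem cq_bot_mul (c : V) : ⊥ * c = ⊥ := by
  rw [mul_comm, cq_mul_bot]

theorem cq_mul_le_left (hk : (1 : V) = ⊤) (p q : V) : p * q ≤ p := by
  have := cq_mul_mono (le_refl p) (show q ≤ 1 from hk ▸ le_top)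
  rwa [mul_one] at this

theorem cq_mul_le_right (hk : (1 : V) = ⊤) (p q : V) : p * q ≤ q := by
  rw [mul_comm]; exact cq_mul_le_left hk q p

/-- if `k = ⊤` in `V`, then
`GH(X,X') ⊗ GH(Y,Y') ≤ GH(X × Y, X' × Y')` (Cartesian product, structure
`(a×b)((x,y),(x',y')) = a(x,x') ∧ b(y,y')`) and
`GH(X,X') ⊗ GH(Y,Y') ≤ GH(X + Y, X' + Y')` (coproduct).  Hence both product and
coproduct make the Gromov–Hausdorff V-category a monoid in the monoidal category of
large V-categories. -/
theorem GH_product_coproduct_monoid (hk : (1 : V) = ⊤) {X X' Y Y' : Type v}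
    (a : X → X → V) (a' : X' → X' → V) (b : Y → Y → V) (b' : Y' → Y' → V)
    (ha : IsVCat a) (ha' : IsVCat a') (hb : IsVCat b) (hb' : IsVCat b') :
    (GH a a' * GH b b' ≤
      GH (fun p q : X × Y => a p.1 q.1 ⊓ b p.2 q.2)
         (fun p q : X' × Y' => a' p.1 q.1 ⊓ b' p.2 q.2)) ∧
    (GH a a' * GH b b' ≤ GH (sumStruct a b) (sumStruct a' b')) := by
  refine ⟨cq_iSup_mul_le _ _ _ ?_, cq_iSup_mul_le _ _ _ ?_⟩
  · rintro ⟨φ, hφ⟩ ⟨ψ, hψ⟩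
    refine le_iSup_of_le ⟨fun p q => φ p.1 q.1 ⊓ ψ p.2 q.2, ⟨?_, ?_⟩⟩ ?_
    · intro x' x y
      exact le_inf ((cq_mul_mono inf_le_left inf_le_left).trans (hφ.1 _ _ _))
        ((cq_mul_mono inf_le_right inf_le_right).trans (hψ.1 _ _ _))
    · intro x y y'
      exact le_inf ((cq_mul_mono inf_le_left inf_le_left).trans (hφ.2 _ _ _))
        ((cq_mul_mono inf_le_right inf_le_right).trans (hψ.2 _ _ _))
    · simp only [hf, Set.mem_univ, iInf_pos, iSup_pos]
      refine le_iInf fun p => ?_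
      refine (cq_mul_mono (iInf_le _ p.1) (iInf_le _ p.2)).trans ?_
      refine cq_iSup_mul_le _ _ _ fun i j => ?_
      exact le_iSup_of_le (i, j) (le_inf (cq_mul_le_left hk _ _) (cq_mul_le_right hk _ _))
  · rintro ⟨φ, hφ⟩ ⟨ψ, hψ⟩
    refine le_iSup_of_le ⟨fun p q => match p, q with
      | Sum.inl x, Sum.inl x' => φ x x'
      | Sum.inr y, Sum.inr y' => ψ y y'
      | _, _ => ⊥, ⟨?_, ?_⟩⟩ ?_
    · rintro (x' | x') (x | x) (y | y) <;>
        simp only [sumStruct, cq_mul_bot, cq_bot_mul, le_refl, bot_le]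
      · exact hφ.1 _ _ _
      · exact hψ.1 _ _ _
    · rintro (x | x) (y | y) (y' | y') <;>
        simp only [sumStruct, cq_mul_bot, cq_bot_mul, le_refl, bot_le]
      · exact hφ.2 _ _ _
      · exact hψ.2 _ _ _
    · simp only [hf, Set.mem_univ, iInf_pos, iSup_pos]
      refine le_iInf fun p => ?_
      rcases p with x | y
      · refine (cq_mul_le_left hk _ _).trans ((iInf_le _ x).trans ?_)
        exact iSup_le fun i => le_iSup_of_le (Sum.inl i) le_rfl
      · refine (cq_mul_le_right hk _ _).trans ((iInf_le _ y).trans ?_)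
        exact iSup_le fun i => le_iSup_of_le (Sum.inr i) le_rfl
end

section
/- A V-category (X,a) is separated when k ≤ a(x,y) and k ≤ a(y,x) imply x = y. For all separated V-categories X = (X,a) and Y = (Y,b): GH(X,Y) = ⋁_{X ↪ Z ↩ Y, Z separated} h_Z(X,Y) = ⋁_{c separated} ⋀_{x∈X} ⋁_{y∈Y} c(x,y), where the first join ranges over separated V-categories Z with fully faithful injective V-functors from X and from Y into Z, and the second over separated V-category structures c on the disjoint union X ⊔ Y whose restrictions to X and to Y are a and b. In other words, in computing GH(X,Y) for separated X and Y the amalgamating structures may be taken separated without changing the value. -/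
universe u v

variable {V : Type u} [CommQuantale V]

/-- A V-category structure is separated when `k ≤ a(x,y)` and `k ≤ a(y,x)`
imply `x = y`. -/
def Separated {X : Type*} (a : X → X → V) : Prop :=
  ∀ x y, (1 : V) ≤ a x y → (1 : V) ≤ a y x → x = y

/-- for separated V-categories `X`, `Y`, the amalgamating structures in
the formula for `GH(X,Y)` may be taken separated without changing the value:
`GH(X,Y) = ⋁_{X ↪ Z ↩ Y, Z separated} h_Z(X,Y)
        = ⋁_{c separated} ⋀_{x∈X}⋁_{y∈Y} c(x,y)`. -/
theorem GH_separated_amalgamation {X Y : Type v} (a : X → X → V) (b : Y → Y → V)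
    (ha : IsVCat a) (hb : IsVCat b) (hsa : Separated a) (hsb : Separated b) :
    (GH a b
      = ⨆ (Z : Type v) (c : Z → Z → V) (_ : IsVCat c) (_ : Separated c)
          (f : X → Z) (g : Y → Z)
          (_ : Function.Injective f) (_ : Function.Injective g)
          (_ : ∀ x x', a x x' = c (f x) (f x'))
          (_ : ∀ y y', b y y' = c (g y) (g y')),
          hf c (Set.range f) (Set.range g)) ∧
    (GH a b
      = ⨆ (c : (X ⊕ Y) → (X ⊕ Y) → V) (_ : IsVCat c) (_ : Separated c)
          (_ : ∀ x x', c (Sum.inl x) (Sum.inl x') = a x x')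
          (_ : ∀ y y', c (Sum.inr y) (Sum.inr y') = b y y'),
          ⨅ x : X, ⨆ y : Y, c (Sum.inl x) (Sum.inr y)) := by
  have key : ∀ φ : X → Y → V, IsVMod a b φ →
      ∃ c : (X ⊕ Y) → (X ⊕ Y) → V, IsVCat c ∧ Separated c ∧
        (∀ x x', c (Sum.inl x) (Sum.inl x') = a x x') ∧
        (∀ y y', c (Sum.inr y) (Sum.inr y') = b y y') ∧
        (∀ x y, c (Sum.inl x) (Sum.inr y) = φ x y) := by
    intro φ hφ
    have mb : ∀ v : V, v * ⊥ = ⊥ := fun v => by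
      have h := CommQuantale.mul_sSup v ∅
      simpa using h
    have bm : ∀ v : V, ⊥ * v = ⊥ := fun v => by rw [mul_comm, mb]
    have nb : ¬ ((1 : V) ≤ ⊥) := not_le_of_gt CommQuantale.bot_lt_one
    refine ⟨fun p q => Sum.elim
      (fun x => Sum.elim (fun x' => a x x') (fun y => φ x y) q)
      (fun y => Sum.elim (fun _ => ⊥) (fun y' => b y y') q) p, ⟨?_, ?_⟩, ?_,
      fun _ _ => rfl, fun _ _ => rfl, fun _ _ => rfl⟩
    · rintro (x | y)
      · exact ha.1 x
      · exact hb.1 y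
    · rintro (x | x) (y | y) (z | z) <;> simp only [Sum.elim_inl, Sum.elim_inr, mb, bm, bot_le, le_refl]
      · exact ha.2 x y z
      · exact hφ.1 x y z
      · exact hφ.2 x y z
      · exact hb.2 x y z
    · rintro (x | x) (y | y) h1 h2
      · exact congrArg _ (hsa x y h1 h2)
      · exact absurd h2 nb
      · exact absurd h1 nb
      · exact congrArg _ (hsb x y h1 h2)
  have up : ∀ φ : X → Y → V, IsVMod a b φ → (⨅ x : X, ⨆ y : Y, φ x y) ≤ GH a b := by
    intro φ hφ
    refine le_trans (le_of_eq ?_) (le_iSup (fun φ : {φ : X → Y → V // IsVMod a b φ} =>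
      hf φ.1 Set.univ Set.univ) ⟨φ, hφ⟩)
    simp [hf]
  have dn : ∀ B : V, (∀ φ : X → Y → V, IsVMod a b φ → (⨅ x : X, ⨆ y : Y, φ x y) ≤ B) →
      GH a b ≤ B := by
    intro B h
    refine iSup_le fun φ => le_trans (le_of_eq ?_) (h φ.1 φ.2)
    simp [hf]
  constructor
  · apply le_antisymm
    · apply dn
      intro φ hφ
      obtain ⟨c, h1, h2, h3, h4, h5⟩ := key φ hφ
      refine le_iSup_of_le (X ⊕ Y) <| le_iSup_of_le c <| le_iSup_of_le h1 <|
        le_iSup_of_le h2 <| le_iSup_of_le Sum.inl <| le_iSup_of_le Sum.inr <|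
        le_iSup_of_le Sum.inl_injective <| le_iSup_of_le Sum.inr_injective <|
        le_iSup_of_le (fun x x' => (h3 x x').symm) <|
        le_iSup_of_le (fun x x' => (h4 x x').symm) ?_
      simp only [hf, iInf_range, iSup_range, h5, le_refl]
    · refine iSup_le fun Z => iSup_le fun c => iSup_le fun h1 => iSup_le fun _ =>
        iSup_le fun f => iSup_le fun g => iSup_le fun _ => iSup_le fun _ =>
        iSup_le fun h3 => iSup_le fun h4 => ?_
      simp only [hf, iInf_range, iSup_range]
      apply up (fun x y => c (f x) (g y))
      refine ⟨fun x' x y => ?_, fun x y y' => ?_⟩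
      · rw [h3]; exact h1.2 _ _ _
      · rw [h4]; exact h1.2 _ _ _
  · apply le_antisymm
    · apply dn
      intro φ hφ
      obtain ⟨c, h1, h2, h3, h4, h5⟩ := key φ hφ
      refine le_iSup_of_le c <| le_iSup_of_le h1 <| le_iSup_of_le h2 <|
        le_iSup_of_le h3 <| le_iSup_of_le h4 ?_
      simp only [h5, le_refl]
    · refine iSup_le fun c => iSup_le fun h1 => iSup_le fun _ =>
        iSup_le fun h3 => iSup_le fun h4 => ?_
      apply up (fun x y => c (Sum.inl x) (Sum.inr y))
      refine ⟨fun x' x y => ?_, fun x y y' => ?_⟩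
      · rw [← h3]; exact h1.2 _ _ _
      · rw [← h4]; exact h1.2 _ _ _
end
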